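/- Let M ⊂ ℝ^d be nonempty, compact, and connected (in the paper, a connected compact C⁴ manifold without boundary), let ε > 0, and set T_M(ε) := {x : dist(x,M) < ε}. Let f_θ(x) = f_0(x) + f̃(x,θ) be such that exp(−f_θ(x)/θ) is a probability density on ℝ^d, where: (i) f_0 is continuous, argmin over the closure of T_M(ε) of f_0 equals M, and the minimum of f_0 over the closure of T_M(ε) is 0; (ii) f̃(·,θ) is continuous and sup over the closure of T_M(ε) of |f̃(x,θ)| → 0 as θ → 0; (iii) ∫_{T_M(ε)} exp(−f_θ(x)/θ) dx → 1 as θ → 0. Then for every η > 0, setting C_η := {x : f_0(x) > η}, one has ∫_{C_η ∪ T_M(ε)^c} exp(−f_θ(x)/θ) dx → 0 as θ → 0. If, in addition, the probability measures with densities exp(−f_θ/θ) converge weakly to a measure P as θ → 0, then the support of P is contained in M. -/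

import Mathlib

open MeasureTheory Real Filter Set
open scoped Topology

noncomputable section

/-- The mass that Gibbs weights `exp (-g θ / θ)` put on a set of finite measure where `g θ ≥ c > 0`
vanishes as `θ → 0`. -/
theorem tendsto_setIntegral_exp_neg_div {α : Type*} [MeasurableSpace α] {μ : Measure α}
    {s : Set α} (hμs : μ s ≠ ⊤) {g : ℝ → α → ℝ} {c : ℝ} (hc : 0 < c)
    (hg : ∀ᶠ θ in 𝓝[>] (0 : ℝ), ∀ x ∈ s, c ≤ g θ x) :
    Tendsto (fun θ : ℝ => ∫ x in s, Real.exp (-(g θ x) / θ) ∂μ) (𝓝[>] (0 : ℝ)) (𝓝 0) := by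
  have hexp : Tendsto (fun θ : ℝ => Real.exp (-(c * θ⁻¹)) * μ.real s) (𝓝[>] (0 : ℝ)) (𝓝 0) := by
    have h := Real.tendsto_exp_neg_atTop_nhds_zero.comp
      (tendsto_inv_nhdsGT_zero.const_mul_atTop hc)
    simpa using h.mul_const (μ.real s)
  refine squeeze_zero' (Eventually.of_forall fun θ => integral_nonneg fun x => (exp_pos _).le)
    ?_ hexp
  filter_upwards [hg, self_mem_nhdsWithin] with θ hθ (hθpos : 0 < θ)
  refine (Real.le_norm_self _).trans
    (norm_setIntegral_le_of_norm_le_const hμs.lt_top fun x hx => ?_)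
  rw [Real.norm_of_nonneg (exp_pos _).le, Real.exp_le_exp, ← div_eq_mul_inv, neg_div]
  exact neg_le_neg (div_le_div_of_nonneg_right (hθ x hx) hθpos.le)

/-- If nonnegative densities put vanishing mass on a neighbourhood `u` of `x` and converge weakly
to `P`, then some neighbourhood of `x` is `P`-null. -/
theorem exists_isOpen_measure_zero_of_tendsto {X ι : Type*} [MetricSpace X]
    [MeasurableSpace X] [BorelSpace X] {μ P : Measure X} [IsFiniteMeasure P]
    {l : Filter ι} [l.NeBot] {w : ι → X → ℝ} (hw : ∀ i x, 0 ≤ w i x)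
    (hint : ∀ᶠ i in l, Integrable (w i) μ) {u : Set X} (hu : MeasurableSet u) {x : X}
    (hux : u ∈ 𝓝 x)
    (hmass : Tendsto (fun i => ∫ y in u, w i y ∂μ) l (𝓝 0))
    (hweak : ∀ φ : BoundedContinuousFunction X ℝ,
      Tendsto (fun i => ∫ y, φ y * w i y ∂μ) l (𝓝 (∫ y, φ y ∂P))) :
    ∃ t : Set X, IsOpen t ∧ x ∈ t ∧ P t = 0 := by
  obtain ⟨r, hr, hru⟩ := Metric.mem_nhds_iff.1 hux
  have hφle : ∀ y, max 0 (1 - dist y x / r) ≤ 1 := fun y =>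
    max_le zero_le_one (sub_le_self _ (by positivity))
  let φ : BoundedContinuousFunction X ℝ :=
    BoundedContinuousFunction.ofNormedAddCommGroup (fun y => max 0 (1 - dist y x / r))
      (by fun_prop) 1 fun y => by
        rw [Real.norm_of_nonneg (le_max_left _ _)]
        exact hφle y
  have hφ0 : ∀ y, 0 ≤ φ y := fun y => le_max_left _ _
  have hφ1 : ∀ y, φ y ≤ 1 := hφle
  have hφu : ∀ y ∉ u, φ y = 0 := fun y hy => by
    have hry : r ≤ dist y x := not_lt.1 fun h => hy (hru h)
    exact max_eq_left (sub_nonpos.2 ((one_le_div hr).2 hry))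
  have hlim : Tendsto (fun i => ∫ y, φ y * w i y ∂μ) l (𝓝 0) := by
    refine squeeze_zero' (Eventually.of_forall fun i =>
      integral_nonneg fun y => mul_nonneg (hφ0 y) (hw i y)) ?_ hmass
    filter_upwards [hint] with i hi
    rw [← integral_indicator hu]
    refine integral_mono_of_nonneg (Eventually.of_forall fun y => mul_nonneg (hφ0 y) (hw i y))
      (hi.indicator hu) (Eventually.of_forall fun y => ?_)
    by_cases hy : y ∈ u
    · simpa [hy] using mul_le_of_le_one_left (hw i y) (hφ1 y)
    · simp [hy, hφu y hy]
  have hP : ∫ y, φ y ∂P = 0 := tendsto_nhds_unique (hweak φ) hlim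
  rw [integral_eq_zero_iff_of_nonneg hφ0 (φ.integrable P)] at hP
  refine ⟨Metric.ball x r, Metric.isOpen_ball, Metric.mem_ball_self hr,
    measure_mono_null (fun y hy => ?_) hP⟩
  have : 0 < φ y := lt_max_of_lt_right (sub_pos.2 ((div_lt_one hr).2 hy))
  exact this.ne'

/-- Lemma `lemma:limit_support`: concentration on the set of
minimizers. Let `M` be nonempty, compact and connected, and
`f_θ = f₀ + f̃(·,θ)` with `exp(-f_θ/θ)` a probability density, where `f₀` is
continuous with `argmin_{closure T_M(ε)} f₀ = M` and `min = 0`, `f̃(·,θ) → 0`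
uniformly on the closed tube, and the tube-mass tends to 1. Then for every
`η > 0` the mass of `C_η ∪ T_M(ε)ᶜ` tends to 0; and if the densities converge
weakly to a measure `P`, then `supp P ⊆ M`. -/
theorem statement11
    (d : ℕ)
    (M : Set (EuclideanSpace ℝ (Fin d)))
    (hMne : M.Nonempty) (hMcpt : IsCompact M) (hMconn : IsConnected M)
    (ε : ℝ) (hε : 0 < ε)
    (f₀ : EuclideanSpace ℝ (Fin d) → ℝ)
    (ftil : EuclideanSpace ℝ (Fin d) → ℝ → ℝ)
    (ftheta : ℝ → EuclideanSpace ℝ (Fin d) → ℝ)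
    (hftheta : ∀ θ x, ftheta θ x = f₀ x + ftil x θ)
    -- exp(-f_θ/θ) is a probability density
    (hprob : ∀ θ : ℝ, 0 < θ → ∫ x, Real.exp (-(ftheta θ x) / θ) = 1)
    -- (i) f₀ continuous, argmin over closure(T_M(ε)) equals M, minimum equals 0
    (hf₀cont : Continuous f₀)
    (hf₀M : ∀ x ∈ M, f₀ x = 0)
    (hf₀nonneg : ∀ x ∈ closure {x | Metric.infDist x M < ε}, 0 ≤ f₀ x)
    (hf₀argmin : ∀ x ∈ closure {x | Metric.infDist x M < ε}, f₀ x = 0 → x ∈ M)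
    -- (ii) f̃(·,θ) continuous, uniformly o(1) on the closed tube
    (hftilcont : ∀ θ : ℝ, 0 < θ → Continuous (fun x => ftil x θ))
    (hftil : ∀ δ : ℝ, 0 < δ → ∃ θ₀ : ℝ, 0 < θ₀ ∧ ∀ θ ∈ Ioo (0 : ℝ) θ₀,
      ∀ x ∈ closure {x | Metric.infDist x M < ε}, |ftil x θ| ≤ δ)
    -- (iii) tube-mass tends to 1
    (hmass : Tendsto
      (fun θ : ℝ => ∫ x in {x | Metric.infDist x M < ε}, Real.exp (-(ftheta θ x) / θ))
      (𝓝[>] (0 : ℝ)) (𝓝 1)) :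
    -- conclusion 1: mass of C_η ∪ T_M(ε)ᶜ vanishes
    (∀ η : ℝ, 0 < η →
      Tendsto (fun θ : ℝ =>
          ∫ x in {x | η < f₀ x} ∪ {x | Metric.infDist x M < ε}ᶜ,
            Real.exp (-(ftheta θ x) / θ))
        (𝓝[>] (0 : ℝ)) (𝓝 0)) ∧
    -- conclusion 2: any weak limit is supported in M
    (∀ P : Measure (EuclideanSpace ℝ (Fin d)), IsProbabilityMeasure P →
      (∀ φ : BoundedContinuousFunction (EuclideanSpace ℝ (Fin d)) ℝ,
        Tendsto (fun θ : ℝ => ∫ x, φ x * Real.exp (-(ftheta θ x) / θ))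
          (𝓝[>] (0 : ℝ)) (𝓝 (∫ x, φ x ∂P))) →
      ∀ x ∉ M, ∃ t : Set (EuclideanSpace ℝ (Fin d)), IsOpen t ∧ x ∈ t ∧ P t = 0) := by
  set T : Set (EuclideanSpace ℝ (Fin d)) := {x | Metric.infDist x M < ε} with hT
  have hTopen : IsOpen T := isOpen_lt (Metric.continuous_infDist_pt M) continuous_const
  have hTvol : volume T ≠ ⊤ := by
    have hsub : T ⊆ Metric.thickening ε M := fun x hx =>
      (Metric.mem_thickening_iff_infDist_lt hMne).2 hx
    exact (hMcpt.isBounded.thickening.subset hsub).measure_lt_top.ne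
  have hint : ∀ θ : ℝ, 0 < θ → Integrable (fun x => Real.exp (-(ftheta θ x) / θ)) := fun θ hθ =>
    .of_integral_ne_zero (by rw [hprob θ hθ]; exact one_ne_zero)
  have hCopen : ∀ η : ℝ, IsOpen {x | η < f₀ x} := fun η => isOpen_lt continuous_const hf₀cont
  have hconc : ∀ η : ℝ, 0 < η → Tendsto
      (fun θ : ℝ => ∫ x in {x | η < f₀ x} ∪ Tᶜ, Real.exp (-(ftheta θ x) / θ))
      (𝓝[>] (0 : ℝ)) (𝓝 0) := by
    intro η hη
    have hinner : Tendsto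
        (fun θ : ℝ => ∫ x in {x | η < f₀ x} ∩ T, Real.exp (-(ftheta θ x) / θ))
        (𝓝[>] (0 : ℝ)) (𝓝 0) := by
      refine tendsto_setIntegral_exp_neg_div
        (measure_ne_top_of_subset inter_subset_right hTvol) (half_pos hη) ?_
      obtain ⟨θ₀, hθ₀, hbound⟩ := hftil (η / 2) (half_pos hη)
      filter_upwards [Ioo_mem_nhdsGT hθ₀] with θ hθ x hx
      have hlt : η < f₀ x := hx.1
      have := (abs_le.1 (hbound θ hθ x (subset_closure hx.2))).1
      rw [hftheta]
      linarith
    have hsum := hinner.add (hmass.const_sub 1)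
    rw [sub_self, add_zero] at hsum
    refine hsum.congr' ?_
    filter_upwards [self_mem_nhdsWithin] with θ hθ
    rw [← hprob θ hθ, ← setIntegral_compl hTopen.measurableSet (hint θ hθ),
      ← setIntegral_union (disjoint_compl_right.mono_left inter_subset_right)
        hTopen.measurableSet.compl (hint θ hθ).integrableOn (hint θ hθ).integrableOn,
      inter_union_distrib_right, union_compl_self, inter_univ]
  refine ⟨hconc, fun P _ hweak x hx => ?_⟩
  obtain ⟨η, hη, hnhds⟩ : ∃ η : ℝ, 0 < η ∧ {x | η < f₀ x} ∪ Tᶜ ∈ 𝓝 x := by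
    by_cases hxT : x ∈ closure T
    · have hpos : 0 < f₀ x :=
        (hf₀nonneg x hxT).lt_of_ne fun h => hx (hf₀argmin x hxT h.symm)
      exact ⟨f₀ x / 2, half_pos hpos, mem_of_superset
        ((hCopen _).mem_nhds (half_lt_self hpos)) subset_union_left⟩
    · exact ⟨1, one_pos, mem_of_superset (isClosed_closure.isOpen_compl.mem_nhds hxT)
        ((compl_subset_compl.2 subset_closure).trans subset_union_right)⟩
  exact exists_isOpen_measure_zero_of_tendsto (fun θ y => (exp_pos _).le)
    (by filter_upwards [self_mem_nhdsWithin] with θ hθ using hint θ hθ)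
    ((hCopen η).measurableSet.union hTopen.measurableSet.compl) hnhds (hconc η hη) hweak
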